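/- Let X and W be finite nonempty types, each with a distinguished reference element 0, and let Y = {0,1}. Let p be a strictly positive probability mass function on X × W × Y. Define the reference-coded joint log-linear parameters λ_W(w) = log p(0,w,0) − log p(0,0,0); λ_WX(w,x) = log p(x,w,0) + log p(0,0,0) − log p(x,0,0) − log p(0,w,0); λ_WY(w) = log p(0,w,1) + log p(0,0,0) − log p(0,0,1) − log p(0,w,0); and λ_WXY(w,x) = log p(x,w,1) − log p(x,w,0) − log p(x,0,1) + log p(x,0,0) − log p(0,w,1) + log p(0,w,0) + log p(0,0,1) − log p(0,0,0). Define λ_XY(x,y) and λ_{XY;XY}(x,y) as in the marginal-versus-joint XY-interaction comparison. Then for every x ∈ X, λ_XY(x,1) − λ_{XY;XY}(x,1) = − log [ (1 + Σ_{w≠0} exp(λ_W(w))) / (1 + Σ_{w≠0} exp(λ_W(w) + λ_WX(w,x))) ] + log [ (1 + Σ_{w≠0} exp(λ_W(w) + λ_WY(w))) / (1 + Σ_{w≠0} exp(λ_W(w) + λ_WX(w,x) + λ_WY(w) + λ_WXY(w,x))) ]. -/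

import Mathlib

/-- Normalizing a positive function by its value at `0`: if `g` is the log-ratio of `f` to `f 0`,
then `1 + ∑_{w ≠ 0} exp (g w)` is the sum of `f` divided by `f 0`. -/
lemma one_add_sum_exp_log_sub_log {W : Type*} [Fintype W] [Zero W] [DecidableEq W]
    {f g : W → ℝ} (hf : ∀ w, 0 < f w) (hg : ∀ w, g w = Real.log (f w) - Real.log (f 0)) :
    1 + ∑ w ∈ Finset.univ.filter (fun w : W => w ≠ 0), Real.exp (g w) = (∑ w, f w) / f 0 := by
  have hexp : ∀ w, Real.exp (g w) = f w / f 0 := fun w => by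
    rw [hg, Real.exp_sub, Real.exp_log (hf w), Real.exp_log (hf 0)]
  simp_rw [hexp]
  rw [Finset.filter_ne', Finset.sum_div, ← Finset.add_sum_erase _ _ (Finset.mem_univ 0),
    div_self (hf 0).ne']

/-- Corollary 1 (second part): the difference between the joint and marginal
`XY`-interactions at `y = 1`, expressed via the reference-coded log-linear
parameters of the joint distribution involving `W`. -/
theorem joint_minus_marginal_XY_interaction_loglinear
    {X W : Type*} [Fintype X] [Fintype W] [Nonempty X] [Nonempty W]
    [Zero X] [Zero W] [DecidableEq W]
    (p : X → W → Fin 2 → ℝ)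
    (hpos : ∀ x w y, 0 < p x w y)
    (hsum : ∑ x, ∑ w, ∑ y, p x w y = 1)
    (q : X → Fin 2 → ℝ) (hq : ∀ x y, q x y = ∑ w, p x w y)
    (lamW : W → ℝ)
    (hlamW : ∀ w, lamW w = Real.log (p 0 w 0) - Real.log (p 0 0 0))
    (lamWX : W → X → ℝ)
    (hlamWX : ∀ w x, lamWX w x = Real.log (p x w 0) + Real.log (p 0 0 0)
      - Real.log (p x 0 0) - Real.log (p 0 w 0))
    (lamWY : W → ℝ)
    (hlamWY : ∀ w, lamWY w = Real.log (p 0 w 1) + Real.log (p 0 0 0)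
      - Real.log (p 0 0 1) - Real.log (p 0 w 0))
    (lamWXY : W → X → ℝ)
    (hlamWXY : ∀ w x, lamWXY w x =
      Real.log (p x w 1) - Real.log (p x w 0)
        - Real.log (p x 0 1) + Real.log (p x 0 0)
        - Real.log (p 0 w 1) + Real.log (p 0 w 0)
        + Real.log (p 0 0 1) - Real.log (p 0 0 0))
    (x : X) :
    (Real.log (p x 0 1) + Real.log (p 0 0 0)
      - Real.log (p x 0 0) - Real.log (p 0 0 1)) -
    (Real.log (q x 1) + Real.log (q 0 0)
      - Real.log (q x 0) - Real.log (q 0 1)) =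
    - Real.log
        ((1 + ∑ w ∈ Finset.univ.filter (fun w : W => w ≠ 0), Real.exp (lamW w)) /
         (1 + ∑ w ∈ Finset.univ.filter (fun w : W => w ≠ 0),
            Real.exp (lamW w + lamWX w x)))
    + Real.log
        ((1 + ∑ w ∈ Finset.univ.filter (fun w : W => w ≠ 0),
            Real.exp (lamW w + lamWY w)) /
         (1 + ∑ w ∈ Finset.univ.filter (fun w : W => w ≠ 0),
            Real.exp (lamW w + lamWX w x + lamWY w + lamWXY w x))) := by
  have hqpos : ∀ x y, 0 < q x y := fun x y => by
    rw [hq]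
    exact Finset.sum_pos (fun w _ => hpos x w y) Finset.univ_nonempty
  rw [one_add_sum_exp_log_sub_log (f := fun w => p 0 w 0) (fun w => hpos 0 w 0) hlamW,
    one_add_sum_exp_log_sub_log (f := fun w => p x w 0) (fun w => hpos x w 0)
      (fun w => by rw [hlamW, hlamWX]; ring),
    one_add_sum_exp_log_sub_log (f := fun w => p 0 w 1) (fun w => hpos 0 w 1)
      (fun w => by rw [hlamW, hlamWY]; ring),
    one_add_sum_exp_log_sub_log (f := fun w => p x w 1) (fun w => hpos x w 1)
      (fun w => by rw [hlamW, hlamWX, hlamWY, hlamWXY]; ring)]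
  simp only [← hq]
  have hratio : ∀ x y, q x y / p x 0 y ≠ 0 := fun x y => (div_pos (hqpos x y) (hpos x 0 y)).ne'
  rw [Real.log_div (hratio 0 0) (hratio x 0), Real.log_div (hratio 0 1) (hratio x 1)]
  simp only [Real.log_div (hqpos _ _).ne' (hpos _ _ _).ne']
  ring
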